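/- Let (f,g,ρ) be a warped Berger solution of Ricci flow on S^1×S^3 defined on [0,T) satisfying Assumption B. Then there exists a uniform constant C < ∞ such that for all t sufficiently close to T and all ξ ∈ S^1 one has g(ξ,t) − f(ξ,t) ≤ C·f(ξ,t)³·|log(T−t)|. -/

import Mathlib

open Real Set Filter Topology

noncomputable section

/-- Partial derivative in the first (spatial, `ξ`) variable. -/
def pd1 (φ : ℝ → ℝ → ℝ) (ξ t : ℝ) : ℝ := deriv (fun x => φ x t) ξ

/-- Partial derivative in the second (time) variable: `φ_t`. -/
def pdt (φ : ℝ → ℝ → ℝ) (ξ t : ℝ) : ℝ := deriv (fun τ => φ ξ τ) t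

/-- Derivative with respect to arclength `s` (where `ds = ρ dξ`): `φ_s := ρ⁻¹ ∂_ξ φ`. -/
def Ds (ρ φ : ℝ → ℝ → ℝ) (ξ t : ℝ) : ℝ := pd1 φ ξ t / ρ ξ t

/-- Sectional curvature `κ₁₂ = κ₃₁ = f²/g⁴ − f_s g_s/(f g)`. -/
def k12 (ρ f g : ℝ → ℝ → ℝ) (ξ t : ℝ) : ℝ :=
  (f ξ t) ^ 2 / (g ξ t) ^ 4 - Ds ρ f ξ t * Ds ρ g ξ t / (f ξ t * g ξ t)

/-- Sectional curvature `κ₃₁ = κ₁₂`. -/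
def k31 (ρ f g : ℝ → ℝ → ℝ) (ξ t : ℝ) : ℝ :=
  (f ξ t) ^ 2 / (g ξ t) ^ 4 - Ds ρ f ξ t * Ds ρ g ξ t / (f ξ t * g ξ t)

/-- Sectional curvature `κ₂₃ = (4g² − 3f²)/g⁴ − g_s²/g²`. -/
def k23 (ρ f g : ℝ → ℝ → ℝ) (ξ t : ℝ) : ℝ :=
  (4 * (g ξ t) ^ 2 - 3 * (f ξ t) ^ 2) / (g ξ t) ^ 4 - (Ds ρ g ξ t) ^ 2 / (g ξ t) ^ 2

/-- Sectional curvature `κ₀₁ = −f_ss/f`. -/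
def k01 (ρ f : ℝ → ℝ → ℝ) (ξ t : ℝ) : ℝ := -(Ds ρ (Ds ρ f) ξ t) / f ξ t

/-- Sectional curvature `κ₀₂ = κ₀₃ = −g_ss/g`. -/
def k02 (ρ g : ℝ → ℝ → ℝ) (ξ t : ℝ) : ℝ := -(Ds ρ (Ds ρ g) ξ t) / g ξ t

/-- Scalar curvature `R = κ₀₁ + 2κ₀₂ + 2κ₁₂ + κ₂₃`. -/
def scalR (ρ f g : ℝ → ℝ → ℝ) (ξ t : ℝ) : ℝ :=
  k01 ρ f ξ t + 2 * k02 ρ g ξ t + 2 * k12 ρ f g ξ t + k23 ρ f g ξ t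

/-- `M(ξ,t) := min {f(ξ,t), g(ξ,t)}`. -/
def M (f g : ℝ → ℝ → ℝ) (ξ t : ℝ) : ℝ := min (f ξ t) (g ξ t)

/-- `M̌(t) := min_{ξ ∈ S¹} M(ξ,t)`. -/
def Mcheck (f g : ℝ → ℝ → ℝ) (t : ℝ) : ℝ := ⨅ ξ : ℝ, M f g ξ t

/-- A warped Berger solution of Ricci flow on `S¹ × S³` with (finite) existence time `T`:
smooth positive `2π`-periodic-in-`ξ` functions `f, g, ρ` on `S¹ × [0,T)` satisfying
  `f_t = f_ss + 2 (g_s/g) f_s − 2 f³/g⁴`,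
  `g_t = g_ss + (f_s/f + g_s/g) g_s + 2 (f² − 2g²)/g³`,
  `(log ρ)_t = f_ss/f + 2 g_ss/g`. -/
structure WarpedBerger (T : ℝ) (f g ρ : ℝ → ℝ → ℝ) : Prop where
  T_pos : 0 < T
  f_pos : ∀ ξ t : ℝ, 0 ≤ t → t < T → 0 < f ξ t
  g_pos : ∀ ξ t : ℝ, 0 ≤ t → t < T → 0 < g ξ t
  ρ_pos : ∀ ξ t : ℝ, 0 ≤ t → t < T → 0 < ρ ξ t
  f_per : ∀ ξ t : ℝ, f (ξ + 2 * π) t = f ξ t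
  g_per : ∀ ξ t : ℝ, g (ξ + 2 * π) t = g ξ t
  ρ_per : ∀ ξ t : ℝ, ρ (ξ + 2 * π) t = ρ ξ t
  smooth : ContDiffOn ℝ (⊤ : ℕ∞)
      (fun p : ℝ × ℝ => (f p.1 p.2, g p.1 p.2, ρ p.1 p.2)) (Set.univ ×ˢ Set.Ico 0 T)
  eq_f : ∀ ξ t : ℝ, 0 < t → t < T →
    pdt f ξ t = Ds ρ (Ds ρ f) ξ t + 2 * (Ds ρ g ξ t / g ξ t) * Ds ρ f ξ t
      - 2 * (f ξ t) ^ 3 / (g ξ t) ^ 4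
  eq_g : ∀ ξ t : ℝ, 0 < t → t < T →
    pdt g ξ t = Ds ρ (Ds ρ g) ξ t
      + (Ds ρ f ξ t / f ξ t + Ds ρ g ξ t / g ξ t) * Ds ρ g ξ t
      + 2 * ((f ξ t) ^ 2 - 2 * (g ξ t) ^ 2) / (g ξ t) ^ 3
  eq_ρ : ∀ ξ t : ℝ, 0 < t → t < T →
    pdt (fun x τ => Real.log (ρ x τ)) ξ t
      = Ds ρ (Ds ρ f) ξ t / f ξ t + 2 * (Ds ρ (Ds ρ g) ξ t / g ξ t)

/-- The Ricci curvature blows up as `t ↗ T`: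
`limsup_{t↗T} max_ξ (|κ₀₁+2κ₁₂| + |κ₀₁+2κ₀₂| + |κ₀₂+κ₁₂+κ₂₃|) = ∞`, where the three
displayed quantities are the diagonal components of the Ricci tensor. -/
def RicciBlowup (T : ℝ) (f g ρ : ℝ → ℝ → ℝ) : Prop :=
  ∀ K : ℝ, ∀ t₀ : ℝ, 0 ≤ t₀ → t₀ < T → ∃ ξ t : ℝ, t₀ < t ∧ t < T ∧
    K < |k01 ρ f ξ t + 2 * k12 ρ f g ξ t| + |k01 ρ f ξ t + 2 * k02 ρ g ξ t|
        + |k02 ρ g ξ t + k12 ρ f g ξ t + k23 ρ f g ξ t|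

/-- Assumption A: `f ≤ g` at `t = 0`; `(min_ξ R(ξ,0))·(max_ξ g(ξ,0)²) > −3`;
and the Ricci curvature blows up at the finite time `T`. -/
structure AssumptionA (T : ℝ) (f g ρ : ℝ → ℝ → ℝ) extends WarpedBerger T f g ρ : Prop where
  init_order : ∀ ξ : ℝ, f ξ 0 ≤ g ξ 0
  init_scalar : (⨅ ξ : ℝ, scalR ρ f g ξ 0) * (⨆ ξ : ℝ, (g ξ 0) ^ 2) > -3
  ricci_blowup : RicciBlowup T f g ρ

/-- Assumption B: Assumption A and, in addition, at `t = 0` one has `f ≥ (1−ε)g` for some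
`ε ∈ (0,1)` with `2(1−ε)⁵ + 4(1−ε)⁴ > 4/3`, and `|f_s| ≤ 1` at `t = 0`. -/
structure AssumptionB (T : ℝ) (f g ρ : ℝ → ℝ → ℝ) extends AssumptionA T f g ρ : Prop where
  init_pinched : ∃ ε : ℝ, 0 < ε ∧ ε < 1 ∧ 2 * (1 - ε) ^ 5 + 4 * (1 - ε) ^ 4 > 4 / 3 ∧
    ∀ ξ : ℝ, (1 - ε) * g ξ 0 ≤ f ξ 0
  init_fs : ∀ ξ : ℝ, |Ds ρ f ξ 0| ≤ 1

def SS (T : ℝ) : Set (ℝ × ℝ) := Set.univ ×ˢ Set.Ico 0 T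

def Sm (T : ℝ) (u : ℝ → ℝ → ℝ) : Prop :=
  ContDiffOn ℝ (⊤ : ℕ∞) (fun p : ℝ × ℝ => u p.1 p.2) (SS T)

lemma SS_unique (T : ℝ) : UniqueDiffOn ℝ (SS T) :=
  uniqueDiffOn_univ.prod (uniqueDiffOn_Ico 0 T)

lemma Sm.const (T c : ℝ) : Sm T (fun _ _ => c) := contDiffOn_const

lemma Sm.add {T : ℝ} {u v : ℝ → ℝ → ℝ} (hu : Sm T u) (hv : Sm T v) :
    Sm T (fun x τ => u x τ + v x τ) := ContDiffOn.add hu hv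

lemma Sm.mul {T : ℝ} {u v : ℝ → ℝ → ℝ} (hu : Sm T u) (hv : Sm T v) :
    Sm T (fun x τ => u x τ * v x τ) := ContDiffOn.mul hu hv

lemma Sm.inv {T : ℝ} {u : ℝ → ℝ → ℝ} (hu : Sm T u)
    (h : ∀ ξ t : ℝ, 0 ≤ t → t < T → 0 < u ξ t) :
    Sm T (fun x τ => (u x τ)⁻¹) :=
  ContDiffOn.inv hu (fun p hp => (h p.1 p.2 hp.2.1 hp.2.2).ne')

lemma Sm.cd1 {T : ℝ} {u : ℝ → ℝ → ℝ} (hu : Sm T u) {t : ℝ} (h0 : 0 ≤ t) (h1 : t < T) :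
    ContDiff ℝ (⊤ : ℕ∞) (fun x => u x t) := by
  have h : ContDiffOn ℝ (⊤ : ℕ∞) (fun x : ℝ => (x, t)) Set.univ :=
    (contDiff_id.prodMk contDiff_const).contDiffOn
  have := ContDiffOn.comp hu h (fun x _ => ⟨mem_univ _, h0, h1⟩)
  exact contDiffOn_univ.1 this

lemma Sm.d1 {T : ℝ} {u : ℝ → ℝ → ℝ} (hu : Sm T u) {t : ℝ} (h0 : 0 ≤ t) (h1 : t < T) (x : ℝ) :
    DifferentiableAt ℝ (fun x => u x t) x :=
  ((hu.cd1 h0 h1).differentiable (by simp)).differentiableAt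

lemma Sm.cdat {T : ℝ} {u : ℝ → ℝ → ℝ} (hu : Sm T u) {x t : ℝ} (h0 : 0 < t) (h1 : t < T) :
    ContDiffAt ℝ (⊤ : ℕ∞) (fun p : ℝ × ℝ => u p.1 p.2) (x, t) := by
  apply ContDiffOn.contDiffAt hu
  exact prod_mem_nhds univ_mem (Ico_mem_nhds h0 h1)

lemma Sm.dt {T : ℝ} {u : ℝ → ℝ → ℝ} (hu : Sm T u) {x t : ℝ} (h0 : 0 < t) (h1 : t < T) :
    DifferentiableAt ℝ (fun τ => u x τ) t := by
  have h : DifferentiableAt ℝ (fun p : ℝ × ℝ => u p.1 p.2) (x, t) :=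
    (hu.cdat h0 h1).differentiableAt (by simp)
  exact h.comp t ((differentiableAt_const x).prodMk differentiableAt_id)

lemma Sm.pd1_eq {T : ℝ} {u : ℝ → ℝ → ℝ} (hu : Sm T u) {x t : ℝ} (h0 : 0 ≤ t) (h1 : t < T) :
    pd1 u x t = fderivWithin ℝ (fun p : ℝ × ℝ => u p.1 p.2) (SS T) (x, t) (1, 0) := by
  have hd : HasFDerivWithinAt (fun p : ℝ × ℝ => u p.1 p.2)
      (fderivWithin ℝ (fun p : ℝ × ℝ => u p.1 p.2) (SS T) (x, t)) (SS T) (x, t) :=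
    ((ContDiffOn.differentiableOn hu (by simp)) (x, t) ⟨mem_univ _, h0, h1⟩).hasFDerivWithinAt
  have hc : HasDerivWithinAt (fun y : ℝ => (y, t)) ((1 : ℝ), (0 : ℝ)) Set.univ x :=
    ((hasDerivAt_id x).prodMk (hasDerivAt_const x t)).hasDerivWithinAt
  have hmt : MapsTo (fun y : ℝ => (y, t)) Set.univ (SS T) := fun y _ => ⟨mem_univ _, h0, h1⟩
  have := hd.comp_hasDerivWithinAt x hc hmt
  exact (hasDerivWithinAt_univ.1 this).deriv

lemma Sm.pdx {T : ℝ} {u : ℝ → ℝ → ℝ} (hu : Sm T u) : Sm T (pd1 u) := by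
  have h : ContDiffOn ℝ (⊤ : ℕ∞) (fderivWithin ℝ (fun p : ℝ × ℝ => u p.1 p.2) (SS T)) (SS T) :=
    ((contDiffOn_infty_iff_fderivWithin (SS_unique T)).1 hu).2
  have h2 : ContDiffOn ℝ (⊤ : ℕ∞)
    (fun p => fderivWithin ℝ (fun p : ℝ × ℝ => u p.1 p.2) (SS T) p (1, 0)) (SS T) :=
    h.clm_apply contDiffOn_const
  refine h2.congr ?_
  rintro ⟨x, t⟩ ⟨_, h0, h1⟩
  exact hu.pd1_eq h0 h1

lemma Sm.ds {T : ℝ} {ρ u : ℝ → ℝ → ℝ} (hu : Sm T u) (hρ : Sm T ρ)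
    (h : ∀ ξ t : ℝ, 0 ≤ t → t < T → 0 < ρ ξ t) : Sm T (Ds ρ u) :=
  hu.pdx.mul (hρ.inv h)

lemma le2top : (2 : WithTop ℕ∞) ≤ ((⊤ : ℕ∞) : WithTop ℕ∞) := by
  exact WithTop.coe_le_coe.2 (le_top : (2 : ℕ∞) ≤ ⊤)

lemma Sm.swap {T : ℝ} {u : ℝ → ℝ → ℝ} (hu : Sm T u) {x t : ℝ} (h0 : 0 < t) (h1 : t < T) :
    pdt (pd1 u) x t = pd1 (pdt u) x t := by
  set U : ℝ × ℝ → ℝ := fun p => u p.1 p.2 with hU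
  have hsym : IsSymmSndFDerivAt ℝ U (x, t) :=
    (hu.cdat h0 h1).isSymmSndFDerivAt (by simpa using le2top)
  have hD : ∀ y τ, 0 < τ → τ < T → DifferentiableAt ℝ U (y, τ) := fun y τ a b =>
    (hu.cdat a b).differentiableAt (by simp)
  have hDD : DifferentiableAt ℝ (fderiv ℝ U) (x, t) :=
    ((hu.cdat h0 h1).fderiv_right (m := 1) (by simpa [one_add_one_eq_two] using le2top)).differentiableAt (by simp)
  have e1 : ∀ y τ, 0 < τ → τ < T → pd1 u y τ = fderiv ℝ U (y, τ) (1, 0) := by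
    intro y τ a b
    exact (((hD y τ a b).hasFDerivAt).comp_hasDerivAt y
      ((hasDerivAt_id y).prodMk (hasDerivAt_const y τ))).deriv
  have e2 : ∀ y τ, 0 < τ → τ < T → pdt u y τ = fderiv ℝ U (y, τ) (0, 1) := by
    intro y τ a b
    exact (((hD y τ a b).hasFDerivAt).comp_hasDerivAt τ
      ((hasDerivAt_const τ y).prodMk (hasDerivAt_id τ))).deriv
  have r1 : pdt (pd1 u) x t = fderiv ℝ (fderiv ℝ U) (x, t) (0, 1) (1, 0) := by
    have a : (fun τ => pd1 u x τ) =ᶠ[𝓝 t] fun τ => fderiv ℝ U (x, τ) (1, 0) := by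
      filter_upwards [Ioo_mem_nhds h0 h1] with τ hτ using e1 x τ hτ.1 hτ.2
    unfold pdt
    rw [a.deriv_eq]
    have := (hDD.hasFDerivAt).comp_hasDerivAt t
      ((hasDerivAt_const t x).prodMk (hasDerivAt_id t))
    have k := this.clm_apply (hasDerivAt_const t ((1 : ℝ), (0 : ℝ)))
    simpa using k.deriv
  have r2 : pd1 (pdt u) x t = fderiv ℝ (fderiv ℝ U) (x, t) (1, 0) (0, 1) := by
    have a : (fun y => pdt u y t) = fun y => fderiv ℝ U (y, t) (0, 1) := by
      funext y; exact e2 y t h0 h1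
    unfold pd1
    rw [a]
    have := (hDD.hasFDerivAt).comp_hasDerivAt x
      ((hasDerivAt_id x).prodMk (hasDerivAt_const x t))
    have k := this.clm_apply (hasDerivAt_const x ((0 : ℝ), (1 : ℝ)))
    simpa using k.deriv
  rw [r1, r2]
  exact hsym _ _

lemma Ds_const (ρ : ℝ → ℝ → ℝ) (c ξ t : ℝ) : Ds ρ (fun _ _ => c) ξ t = 0 := by
  simp [Ds, pd1]

lemma Ds_add {T : ℝ} {ρ u v : ℝ → ℝ → ℝ} (hu : Sm T u) (hv : Sm T v) {ξ t : ℝ}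
    (h0 : 0 ≤ t) (h1 : t < T) :
    Ds ρ (fun x τ => u x τ + v x τ) ξ t = Ds ρ u ξ t + Ds ρ v ξ t := by
  unfold Ds pd1
  have := ((hu.d1 h0 h1 ξ).hasDerivAt.add (hv.d1 h0 h1 ξ).hasDerivAt).deriv
  erw [this]; ring

lemma Ds_mul {T : ℝ} {ρ u v : ℝ → ℝ → ℝ} (hu : Sm T u) (hv : Sm T v) {ξ t : ℝ}
    (h0 : 0 ≤ t) (h1 : t < T) :
    Ds ρ (fun x τ => u x τ * v x τ) ξ t = Ds ρ u ξ t * v ξ t + u ξ t * Ds ρ v ξ t := by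
  unfold Ds pd1
  have := ((hu.d1 h0 h1 ξ).hasDerivAt.mul (hv.d1 h0 h1 ξ).hasDerivAt).deriv
  erw [this]; ring

lemma Ds_congr {ρ u v : ℝ → ℝ → ℝ} {t : ℝ} (h : ∀ x, u x t = v x t) (ξ : ℝ) :
    Ds ρ u ξ t = Ds ρ v ξ t := by
  unfold Ds pd1
  have : (fun x => u x t) = fun x => v x t := funext h
  rw [this]

lemma pdt_add {T : ℝ} {u v : ℝ → ℝ → ℝ} (hu : Sm T u) (hv : Sm T v) {ξ t : ℝ}
    (h0 : 0 < t) (h1 : t < T) :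
    pdt (fun x τ => u x τ + v x τ) ξ t = pdt u ξ t + pdt v ξ t := by
  unfold pdt
  exact ((hu.dt h0 h1).hasDerivAt.add (hv.dt h0 h1).hasDerivAt).deriv

lemma pdt_mul {T : ℝ} {u v : ℝ → ℝ → ℝ} (hu : Sm T u) (hv : Sm T v) {ξ t : ℝ}
    (h0 : 0 < t) (h1 : t < T) :
    pdt (fun x τ => u x τ * v x τ) ξ t = pdt u ξ t * v ξ t + u ξ t * pdt v ξ t := by
  unfold pdt
  exact ((hu.dt h0 h1).hasDerivAt.mul (hv.dt h0 h1).hasDerivAt).deriv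

/-- heat operator defect -/
def Ht (ρ f g u : ℝ → ℝ → ℝ) (ξ t : ℝ) : ℝ :=
  pdt u ξ t - Ds ρ (Ds ρ u) ξ t
    - (Ds ρ f ξ t / f ξ t + 2 * (Ds ρ g ξ t / g ξ t)) * Ds ρ u ξ t

lemma Ht_const (ρ f g : ℝ → ℝ → ℝ) (c ξ t : ℝ) : Ht ρ f g (fun _ _ => c) ξ t = 0 := by
  have : Ds ρ (fun _ _ => c) = fun _ _ => (0 : ℝ) := by
    funext a b; exact Ds_const ρ c a b
  unfold Ht
  rw [this, Ds_const]
  simp [pdt]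

lemma Ht_add {T : ℝ} {ρ f g u v : ℝ → ℝ → ℝ} (hρ : Sm T ρ)
    (h : ∀ ξ t : ℝ, 0 ≤ t → t < T → 0 < ρ ξ t) (hu : Sm T u) (hv : Sm T v) {ξ t : ℝ}
    (h0 : 0 < t) (h1 : t < T) :
    Ht ρ f g (fun x τ => u x τ + v x τ) ξ t = Ht ρ f g u ξ t + Ht ρ f g v ξ t := by
  unfold Ht
  rw [pdt_add hu hv h0 h1, Ds_congr (v := fun x τ => Ds ρ u x τ + Ds ρ v x τ) (fun x => Ds_add hu hv h0.le h1) ξ,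
    Ds_add (hu.ds hρ h) (hv.ds hρ h) h0.le h1, Ds_add hu hv h0.le h1]
  ring

lemma Ht_mul {T : ℝ} {ρ f g u v : ℝ → ℝ → ℝ} (hρ : Sm T ρ)
    (h : ∀ ξ t : ℝ, 0 ≤ t → t < T → 0 < ρ ξ t) (hu : Sm T u) (hv : Sm T v) {ξ t : ℝ}
    (h0 : 0 < t) (h1 : t < T) :
    Ht ρ f g (fun x τ => u x τ * v x τ) ξ t = Ht ρ f g u ξ t * v ξ t + u ξ t * Ht ρ f g v ξ t
      - 2 * Ds ρ u ξ t * Ds ρ v ξ t := by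
  unfold Ht
  have hu' := hu.ds hρ h
  have hv' := hv.ds hρ h
  rw [pdt_mul hu hv h0 h1, Ds_congr (v := fun x τ => Ds ρ u x τ * v x τ + u x τ * Ds ρ v x τ)
    (fun x => Ds_mul hu hv h0.le h1) ξ,
    Ds_add (hu'.mul hv) (hu.mul hv') h0.le h1, Ds_mul hu' hv h0.le h1, Ds_mul hu hv' h0.le h1,
    Ds_mul hu hv h0.le h1]
  ring

lemma second_test {φ : ℝ → ℝ} {x : ℝ} (hc : ContinuousAt φ x) (hm : ∀ y, φ y ≤ φ x) :
    deriv (deriv φ) x ≤ 0 := by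
  by_contra hcon
  push Not at hcon
  have hmax : IsLocalMax φ x := Filter.Eventually.of_forall hm
  have hmin := isLocalMin_of_deriv_deriv_pos hcon hmax.deriv_eq_zero hc
  have heq : φ =ᶠ[𝓝 x] fun _ => φ x := by
    filter_upwards [hmin] with y hy using le_antisymm (hm y) hy
  have := heq.deriv.deriv_eq
  rw [this] at hcon
  simp at hcon

lemma max_principle {T : ℝ} {ρ f g u : ℝ → ℝ → ℝ} (hρ : Sm T ρ)
    (hpos : ∀ ξ t : ℝ, 0 ≤ t → t < T → 0 < ρ ξ t) (hu : Sm T u)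
    (hper : ∀ ξ t : ℝ, 0 ≤ t → t < T → u (ξ + 2 * π) t = u ξ t)
    (hinit : ∀ ξ : ℝ, u ξ 0 < 0)
    (hev : ∀ ξ t : ℝ, 0 < t → t < T → u ξ t = 0 → Ds ρ u ξ t = 0 → Ht ρ f g u ξ t < 0) :
    ∀ ξ t : ℝ, 0 ≤ t → t < T → u ξ t < 0 := by
  intro ξ₁ t₁ h0 h1
  by_contra hcon
  push Not at hcon
  have hred : ∀ x t : ℝ, 0 ≤ t → t < T → ∃ y ∈ Icc 0 (2 * π), u x t = u y t := by
    intro x t a b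
    have hp : Function.Periodic (fun x => u x t) (2 * π) := fun x => hper x t a b
    obtain ⟨y, hy, he⟩ := hp.exists_mem_Ico₀ (by positivity) x
    exact ⟨y, ⟨hy.1, hy.2.le⟩, he⟩
  set K : Set (ℝ × ℝ) := (Icc 0 (2 * π) ×ˢ Icc 0 t₁) with hK
  have hKc : IsCompact K := isCompact_Icc.prod isCompact_Icc
  have hKS : K ⊆ SS T := fun p hp => ⟨mem_univ _, hp.2.1, lt_of_le_of_lt hp.2.2 h1⟩
  have hcont : ContinuousOn (fun p : ℝ × ℝ => u p.1 p.2) K := (ContDiffOn.continuousOn hu).mono hKS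
  set A : Set (ℝ × ℝ) := K ∩ (fun p : ℝ × ℝ => u p.1 p.2) ⁻¹' (Ici 0) with hA
  have hAcl : IsClosed A := hcont.preimage_isClosed_of_isClosed hKc.isClosed isClosed_Ici
  have hAc : IsCompact A := hKc.of_isClosed_subset hAcl inter_subset_left
  have hAne : A.Nonempty := by
    obtain ⟨y, hy, he⟩ := hred ξ₁ t₁ h0 h1
    refine ⟨(y, t₁), ⟨hy, h0, le_rfl⟩, ?_⟩
    show 0 ≤ u y t₁
    rw [← he]; exact hcon
  obtain ⟨⟨ξ, t⟩, hmem, hmin⟩ := hAc.exists_isMinOn hAne continuous_snd.continuousOn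
  obtain ⟨⟨hξ, ht0, ht1⟩, hge⟩ := hmem
  have hge : 0 ≤ u ξ t := hge
  simp only at hξ ht0 ht1
  have htT : t < T := lt_of_le_of_lt ht1 h1
  have htpos : 0 < t := by
    rcases ht0.lt_or_eq with h | h
    · exact h
    · rw [← h] at hge; exact absurd (hinit ξ) (not_lt.2 hge)
  have hbefore : ∀ x τ, 0 ≤ τ → τ < t → u x τ < 0 := by
    intro x τ a b
    by_contra hc
    push Not at hc
    obtain ⟨y, hy, he⟩ := hred x τ a (b.trans htT)
    have : (y, τ) ∈ A := ⟨⟨hy, a, b.le.trans ht1⟩, by show 0 ≤ u y τ; rw [← he]; exact hc⟩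
    have := hmin this
    simp only [mem_ofPred_eq] at this
    linarith
  have hle : ∀ x, u x t ≤ 0 := by
    intro x
    have hca : ContinuousAt (fun τ => u x τ) t := (hu.dt htpos htT).continuousAt
    have : Tendsto (fun τ => u x τ) (𝓝[<] t) (𝓝 (u x t)) := hca.tendsto.mono_left nhdsWithin_le_nhds
    refine le_of_tendsto this ?_
    filter_upwards [Ioo_mem_nhdsLT htpos] with τ hτ using (hbefore x τ hτ.1.le hτ.2).le
  have hz : u ξ t = 0 := le_antisymm (hle ξ) hge
  have hmx : ∀ y, (fun x => u x t) y ≤ (fun x => u x t) ξ := fun y => by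
    simp only [hz]; exact hle y
  have hd1 : pd1 u ξ t = 0 :=
    (show IsLocalMax (fun x => u x t) ξ from Filter.Eventually.of_forall hmx).deriv_eq_zero
  have hds : Ds ρ u ξ t = 0 := by rw [Ds, hd1, zero_div]
  have hdd : pd1 (pd1 u) ξ t ≤ 0 := second_test (hu.d1 ht0 htT ξ).continuousAt hmx
  have hdsds : Ds ρ (Ds ρ u) ξ t ≤ 0 := by
    have e : Ds ρ (Ds ρ u) ξ t = pd1 (pd1 u) ξ t / (ρ ξ t) ^ 2 := by
      have h1 := Ds_mul (ρ := ρ) (ξ := ξ) (hu.pdx) (hρ.inv hpos) ht0 htT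
      have h2 : Ds ρ (Ds ρ u) ξ t = Ds ρ (fun x τ => pd1 u x τ * (ρ x τ)⁻¹) ξ t := rfl
      rw [h2, h1, hd1]
      have := (hpos ξ t ht0 htT).ne'
      unfold Ds
      field_simp
      simp
    rw [e]
    exact div_nonpos_of_nonpos_of_nonneg hdd (by positivity)
  have hpt : 0 ≤ pdt u ξ t := by
    have hd := (hu.dt (x := ξ) htpos htT).hasDerivAt
    have hs := (hasDerivAt_iff_tendsto_slope.1 hd)
    have hs2 : Tendsto (slope (fun τ => u ξ τ) t) (𝓝[<] t) (𝓝 (deriv (fun τ => u ξ τ) t)) :=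
      hs.mono_left (nhdsWithin_mono _ (fun a (ha : a < t) => ne_of_lt ha))
    refine ge_of_tendsto hs2 ?_
    filter_upwards [Ioo_mem_nhdsLT htpos] with τ hτ
    rw [slope_def_field, hz]
    exact div_nonneg_of_nonpos (by have := hbefore ξ τ hτ.1.le hτ.2; linarith)
      (by linarith [hτ.2])
  have := hev ξ t htpos htT hz hds
  unfold Ht at this
  rw [hds] at this
  linarith

lemma Ht_congr {T : ℝ} {ρ f g u v : ℝ → ℝ → ℝ}
    (h : ∀ x τ : ℝ, 0 ≤ τ → τ < T → u x τ = v x τ) {ξ t : ℝ} (h0 : 0 < t) (h1 : t < T) :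
    Ht ρ f g u ξ t = Ht ρ f g v ξ t := by
  have e1 : ∀ x, Ds ρ u x t = Ds ρ v x t := fun x => Ds_congr (fun y => h y t h0.le h1) x
  have e2 : pdt u ξ t = pdt v ξ t := by
    unfold pdt
    apply Filter.EventuallyEq.deriv_eq
    filter_upwards [Ioo_mem_nhds h0 h1] with τ hτ using h ξ τ hτ.1.le hτ.2
  unfold Ht
  rw [e2, e1, Ds_congr e1 ξ]

/-- `h = g²/f² - 1` -/
def hh (f g : ℝ → ℝ → ℝ) : ℝ → ℝ → ℝ :=
  fun x τ => (g x τ * g x τ) * ((f x τ)⁻¹ * (f x τ)⁻¹) + (-1)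

section evol
variable {T : ℝ} {f g ρ : ℝ → ℝ → ℝ}

lemma smf (w : WarpedBerger T f g ρ) : Sm T f := w.smooth.fst
lemma smg (w : WarpedBerger T f g ρ) : Sm T g := w.smooth.snd.fst
lemma smρ (w : WarpedBerger T f g ρ) : Sm T ρ := w.smooth.snd.snd
lemma smfi (w : WarpedBerger T f g ρ) : Sm T (fun x τ => (f x τ)⁻¹) := (smf w).inv w.f_pos
lemma smh (w : WarpedBerger T f g ρ) : Sm T (hh f g) :=
  (((smg w).mul (smg w)).mul ((smfi w).mul (smfi w))).add (Sm.const T (-1))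
lemma smp (w : WarpedBerger T f g ρ) : Sm T (Ds ρ f) := (smf w).ds (smρ w) w.ρ_pos
lemma smq (w : WarpedBerger T f g ρ) : Sm T (Ds ρ g) := (smg w).ds (smρ w) w.ρ_pos

lemma Ht_f (w : WarpedBerger T f g ρ) {ξ t : ℝ} (h0 : 0 < t) (h1 : t < T) :
    Ht ρ f g f ξ t = - (Ds ρ f ξ t) ^ 2 / f ξ t - 2 * (f ξ t) ^ 3 / (g ξ t) ^ 4 := by
  unfold Ht; rw [w.eq_f ξ t h0 h1]; ring

lemma Ht_g (w : WarpedBerger T f g ρ) {ξ t : ℝ} (h0 : 0 < t) (h1 : t < T) :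
    Ht ρ f g g ξ t = - (Ds ρ g ξ t) ^ 2 / g ξ t
      + 2 * ((f ξ t) ^ 2 - 2 * (g ξ t) ^ 2) / (g ξ t) ^ 3 := by
  unfold Ht; rw [w.eq_g ξ t h0 h1]; ring

lemma Ds_fi (w : WarpedBerger T f g ρ) {ξ t : ℝ} (h0 : 0 ≤ t) (h1 : t < T) :
    Ds ρ (fun x τ => (f x τ)⁻¹) ξ t = - Ds ρ f ξ t / (f ξ t) ^ 2 := by
  have hf := (w.f_pos ξ t h0 h1).ne'
  have a := Ds_mul (ρ := ρ) (ξ := ξ) (smf w) (smfi w) h0 h1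
  have b : Ds ρ (fun x τ => f x τ * (f x τ)⁻¹) ξ t = Ds ρ (fun _ _ => (1 : ℝ)) ξ t :=
    Ds_congr (fun x => mul_inv_cancel₀ (w.f_pos x t h0 h1).ne') ξ
  rw [b, Ds_const] at a
  field_simp at a ⊢
  linarith

lemma Ht_fi (w : WarpedBerger T f g ρ) {ξ t : ℝ} (h0 : 0 < t) (h1 : t < T) :
    Ht ρ f g (fun x τ => (f x τ)⁻¹) ξ t
      = - (Ds ρ f ξ t) ^ 2 / (f ξ t) ^ 3 + 2 * f ξ t / (g ξ t) ^ 4 := by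
  have hf := (w.f_pos ξ t h0.le h1).ne'
  have hg := (w.g_pos ξ t h0.le h1).ne'
  have a := Ht_mul (f := f) (g := g) (ρ := ρ) (ξ := ξ) (smρ w) w.ρ_pos (smf w) (smfi w) h0 h1
  have b : Ht ρ f g (fun x τ => f x τ * (f x τ)⁻¹) ξ t = Ht ρ f g (fun _ _ => (1 : ℝ)) ξ t :=
    Ht_congr (fun x τ c d => mul_inv_cancel₀ (w.f_pos x τ c d).ne') h0 h1
  rw [b, Ht_const, Ds_fi w h0.le h1, Ht_f w h0 h1] at a
  have a' : Ht ρ f g (fun x τ => (f x τ)⁻¹) ξ t = (f ξ t)⁻¹ * (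
    - ((- (Ds ρ f ξ t) ^ 2 / f ξ t - 2 * (f ξ t) ^ 3 / (g ξ t) ^ 4) * (f ξ t)⁻¹)
     + 2 * Ds ρ f ξ t * (- Ds ρ f ξ t / (f ξ t) ^ 2)) := by
    rw [eq_inv_mul_iff_mul_eq₀ hf]; linarith
  rw [a']
  field_simp
  ring

lemma Ds_h (w : WarpedBerger T f g ρ) {ξ t : ℝ} (h0 : 0 ≤ t) (h1 : t < T) :
    f ξ t * Ds ρ (hh f g) ξ t
      = -2 * (1 + hh f g ξ t) * (Ds ρ f ξ t - f ξ t * Ds ρ g ξ t / g ξ t) := by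
  have hf := (w.f_pos ξ t h0 h1).ne'
  have hg := (w.g_pos ξ t h0 h1).ne'
  unfold hh
  rw [Ds_add (((smg w).mul (smg w)).mul ((smfi w).mul (smfi w))) (Sm.const T (-1)) h0 h1,
    Ds_mul ((smg w).mul (smg w)) ((smfi w).mul (smfi w)) h0 h1, Ds_mul (smg w) (smg w) h0 h1,
    Ds_mul (smfi w) (smfi w) h0 h1, Ds_const, Ds_fi w h0 h1]
  field_simp
  ring

lemma Ht_h (w : WarpedBerger T f g ρ) {ξ t : ℝ} (h0 : 0 < t) (h1 : t < T) :
    (f ξ t) ^ 2 * Ht ρ f g (hh f g) ξ t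
      = -4 * (1 + hh f g ξ t) * (Ds ρ f ξ t - f ξ t * Ds ρ g ξ t / g ξ t) ^ 2
        - 8 * hh f g ξ t * ((f ξ t) ^ 2 / (g ξ t) ^ 2) := by
  have hf := (w.f_pos ξ t h0.le h1).ne'
  have hg := (w.g_pos ξ t h0.le h1).ne'
  unfold hh
  rw [Ht_add (smρ w) w.ρ_pos (((smg w).mul (smg w)).mul ((smfi w).mul (smfi w)))
      (Sm.const T (-1)) h0 h1,
    Ht_mul (smρ w) w.ρ_pos ((smg w).mul (smg w)) ((smfi w).mul (smfi w)) h0 h1,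
    Ht_mul (smρ w) w.ρ_pos (smg w) (smg w) h0 h1,
    Ht_mul (smρ w) w.ρ_pos (smfi w) (smfi w) h0 h1, Ht_const, Ds_mul (smg w) (smg w) h0.le h1,
    Ds_mul (smfi w) (smfi w) h0.le h1, Ds_fi w h0.le h1, Ht_fi w h0 h1, Ht_g w h0 h1]
  field_simp
  ring

lemma pdt_p (w : WarpedBerger T f g ρ) {ξ t : ℝ} (h0 : 0 < t) (h1 : t < T) :
    pdt (Ds ρ f) ξ t = Ds ρ (pdt f) ξ t - Ds ρ f ξ t *
      (Ds ρ (Ds ρ f) ξ t / f ξ t + 2 * (Ds ρ (Ds ρ g) ξ t / g ξ t)) := by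
  have hρ := (w.ρ_pos ξ t h0.le h1).ne'
  have hl : pdt (fun x τ => Real.log (ρ x τ)) ξ t = pdt ρ ξ t / ρ ξ t :=
    (((smρ w).dt (x := ξ) h0 h1).hasDerivAt.log hρ).deriv
  rw [← w.eq_ρ ξ t h0 h1, hl]
  have hsw := (smf w).swap (x := ξ) h0 h1
  have hd : pdt (Ds ρ f) ξ t = (pdt (pd1 f) ξ t * ρ ξ t - pd1 f ξ t * pdt ρ ξ t) / (ρ ξ t) ^ 2 :=
    (((smf w).pdx.dt (x := ξ) h0 h1).hasDerivAt.div ((smρ w).dt (x := ξ) h0 h1).hasDerivAt hρ).deriv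
  rw [hd, hsw]
  unfold Ds
  field_simp

lemma Ds_eqf (w : WarpedBerger T f g ρ) {ξ t : ℝ} (h0 : 0 < t) (h1 : t < T) :
    Ds ρ (pdt f) ξ t = Ds ρ (Ds ρ (Ds ρ f)) ξ t
      + 2 * (Ds ρ (Ds ρ g) ξ t / g ξ t - (Ds ρ g ξ t) ^ 2 / (g ξ t) ^ 2) * Ds ρ f ξ t
      + 2 * (Ds ρ g ξ t / g ξ t) * Ds ρ (Ds ρ f) ξ t
      - 6 * (f ξ t) ^ 2 * Ds ρ f ξ t / (g ξ t) ^ 4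
      + 8 * (f ξ t) ^ 3 * Ds ρ g ξ t / (g ξ t) ^ 5 := by
  have hρ := (w.ρ_pos ξ t h0.le h1).ne'
  have hg := (w.g_pos ξ t h0.le h1).ne'
  rw [Ds_congr (v := fun x τ =>
    Ds ρ (Ds ρ f) x τ + 2 * (Ds ρ g x τ / g x τ) * Ds ρ f x τ
      - 2 * (f x τ) ^ 3 / (g x τ) ^ 4) (fun x => w.eq_f x t h0 h1) ξ]
  have d : ∀ {u : ℝ → ℝ → ℝ}, Sm T u → HasDerivAt (fun x => u x t) (Ds ρ u ξ t * ρ ξ t) ξ := by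
    intro u hu
    have := (hu.d1 h0.le h1 ξ).hasDerivAt
    have e : Ds ρ u ξ t * ρ ξ t = deriv (fun x => u x t) ξ := by
      unfold Ds pd1; field_simp
    rw [e]; exact this
  have sp := smp w
  have spp := sp.ds (smρ w) w.ρ_pos
  have := ((d spp).add ((((d (smq w)).div (d (smg w)) hg).const_mul 2).mul (d sp))).sub
    ((((d (smf w)).pow 3).const_mul 2).div ((d (smg w)).pow 4) (pow_ne_zero 4 hg))
  have k := this.deriv
  rw [Ds, pd1]
  erw [k]
  simp only [Pi.div_apply, Pi.pow_apply, Pi.mul_apply]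
  field_simp
  push_cast
  ring

lemma Ht_p (w : WarpedBerger T f g ρ) {ξ t : ℝ} (h0 : 0 < t) (h1 : t < T) :
    (f ξ t) ^ 2 * Ht ρ f g (Ds ρ f) ξ t
      = -2 * Ds ρ f ξ t * (f ξ t * Ds ρ (Ds ρ f) ξ t)
        - 2 * Ds ρ f ξ t * (f ξ t * Ds ρ g ξ t / g ξ t) ^ 2
        - 6 * ((f ξ t) ^ 2 / (g ξ t) ^ 2) ^ 2 * Ds ρ f ξ t
        + 8 * ((f ξ t) ^ 2 / (g ξ t) ^ 2) ^ 2 * (f ξ t * Ds ρ g ξ t / g ξ t) := by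
  have hf := (w.f_pos ξ t h0.le h1).ne'
  have hg := (w.g_pos ξ t h0.le h1).ne'
  unfold Ht
  rw [pdt_p w h0 h1, Ds_eqf w h0 h1]
  field_simp
  ring

end evol

section main
variable {T : ℝ} {f g ρ : ℝ → ℝ → ℝ}

lemma neg_of_sq_mul {a b : ℝ} (ha : 0 < a) (h : a ^ 2 * b < 0) : b < 0 := by
  by_contra hc
  push Not at hc
  have : 0 ≤ a ^ 2 * b := by positivity
  linarith

lemma per_h (w : WarpedBerger T f g ρ) (ξ t : ℝ) : hh f g (ξ + 2 * π) t = hh f g ξ t := by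
  unfold hh; rw [w.f_per, w.g_per]

lemma per_p (w : WarpedBerger T f g ρ) (ξ t : ℝ) : Ds ρ f (ξ + 2 * π) t = Ds ρ f ξ t := by
  unfold Ds pd1
  rw [w.ρ_per, ← deriv_comp_add_const (fun x => f x t) (2 * π) ξ]
  simp only [w.f_per]

lemma yh (w : WarpedBerger T f g ρ) {ξ t : ℝ} (h0 : 0 ≤ t) (h1 : t < T) :
    (f ξ t) ^ 2 / (g ξ t) ^ 2 * (1 + hh f g ξ t) = 1 := by
  have hf := (w.f_pos ξ t h0 h1).ne'
  have hg := (w.g_pos ξ t h0 h1).ne'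
  unfold hh
  field_simp
  ring

lemma ypos (w : WarpedBerger T f g ρ) {ξ t : ℝ} (h0 : 0 ≤ t) (h1 : t < T) :
    0 < (f ξ t) ^ 2 / (g ξ t) ^ 2 := by
  have hf := w.f_pos ξ t h0 h1
  have hg := w.g_pos ξ t h0 h1
  positivity

lemma Ht_f' (w : WarpedBerger T f g ρ) {ξ t : ℝ} (h0 : 0 < t) (h1 : t < T) :
    (f ξ t) ^ 2 * Ht ρ f g f ξ t
      = f ξ t * (- (Ds ρ f ξ t) ^ 2 - 2 * ((f ξ t) ^ 2 / (g ξ t) ^ 2) ^ 2) := by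
  have hf := (w.f_pos ξ t h0.le h1).ne'
  have hg := (w.g_pos ξ t h0.le h1).ne'
  rw [Ht_f w h0 h1]
  field_simp

lemma stepA (w : WarpedBerger T f g ρ) (hi : ∀ ξ, 0 ≤ hh f g ξ 0) :
    ∀ ξ t : ℝ, 0 ≤ t → t < T → 0 ≤ hh f g ξ t := by
  intro ξ₀ t₀ a b
  by_contra hc
  push Not at hc
  set η := - hh f g ξ₀ t₀ with hη
  have hη0 : 0 < η := by linarith
  have S1 : Sm T (fun _ _ => (-1 : ℝ)) := Sm.const T _
  have key := max_principle (f := f) (g := g) (u := fun x τ => (-1) * hh f g x τ + (-η))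
    (smρ w) w.ρ_pos ((S1.mul (smh w)).add (Sm.const T (-η)))
    (fun ξ t _ _ => by rw [per_h w]) (fun ξ => by have := hi ξ; linarith) ?_ ξ₀ t₀ a b
  · linarith
  · intro ξ t h0 h1 hz hds
    rw [Ds_add (S1.mul (smh w)) (Sm.const T (-η)) h0.le h1, Ds_mul S1 (smh w) h0.le h1,
      Ds_const, Ds_const] at hds
    rw [Ht_add (smρ w) w.ρ_pos (S1.mul (smh w)) (Sm.const T (-η)) h0 h1,
      Ht_mul (smρ w) w.ρ_pos S1 (smh w) h0 h1, Ht_const, Ht_const, Ds_const]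
    have hf := w.f_pos ξ t h0.le h1
    have e1 := Ds_h w (ξ := ξ) h0.le h1
    have e2 := Ht_h w h0 h1 (ξ := ξ)
    have e3 := yh w h0.le h1 (ξ := ξ)
    have e4 := ypos w h0.le h1 (ξ := ξ)
    have hds' : Ds ρ (hh f g) ξ t = 0 := by linarith
    rw [hds', mul_zero] at e1
    have hh1 : 0 < 1 + hh f g ξ t := by
      by_contra hcc
      push Not at hcc
      nlinarith
    have hl : Ds ρ f ξ t - f ξ t * Ds ρ g ξ t / g ξ t = 0 := by
      have := mul_eq_zero.1 e1.symm
      rcases this with h | h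
      · exfalso; linarith
      · exact h
    rw [hl] at e2
    apply neg_of_sq_mul hf
    have : hh f g ξ t = -η := by linarith
    rw [this] at e2
    nlinarith

lemma stepA' (w : WarpedBerger T f g ρ) (hi : ∀ ξ, hh f g ξ 0 < 3) :
    ∀ ξ t : ℝ, 0 ≤ t → t < T → hh f g ξ t < 3 := by
  intro ξ₀ t₀ a b
  have key := max_principle (f := f) (g := g) (u := fun x τ => hh f g x τ + (-3))
    (smρ w) w.ρ_pos ((smh w).add (Sm.const T (-3)))
    (fun ξ t _ _ => by rw [per_h w]) (fun ξ => by have := hi ξ; linarith) ?_ ξ₀ t₀ a b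
  · linarith
  · intro ξ t h0 h1 hz hds
    rw [Ht_add (smρ w) w.ρ_pos (smh w) (Sm.const T (-3)) h0 h1, Ht_const]
    have hf := w.f_pos ξ t h0.le h1
    have e2 := Ht_h w h0 h1 (ξ := ξ)
    have e4 := ypos w h0.le h1 (ξ := ξ)
    have : hh f g ξ t = 3 := by linarith
    rw [this] at e2
    apply neg_of_sq_mul hf
    nlinarith [sq_nonneg (Ds ρ f ξ t - f ξ t * Ds ρ g ξ t / g ξ t)]

lemma step1 (w : WarpedBerger T f g ρ) (hA : ∀ ξ t : ℝ, 0 ≤ t → t < T → 0 ≤ hh f g ξ t)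
    (hi : ∀ ξ, (Ds ρ f ξ 0) ^ 2 ≤ 1) :
    ∀ ξ t : ℝ, 0 ≤ t → t < T → (Ds ρ f ξ t) ^ 2 < 3 / 2 := by
  intro ξ₀ t₀ a b
  have sp := smp w
  have key := max_principle (f := f) (g := g)
    (u := fun x τ => Ds ρ f x τ * Ds ρ f x τ + (-(3 / 2)))
    (smρ w) w.ρ_pos ((sp.mul sp).add (Sm.const T (-(3 / 2))))
    (fun ξ t _ _ => by rw [per_p w]) (fun ξ => by have := hi ξ; nlinarith) ?_ ξ₀ t₀ a b
  · nlinarith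
  · intro ξ t h0 h1 hz hds
    rw [Ds_add (sp.mul sp) (Sm.const T _) h0.le h1, Ds_mul sp sp h0.le h1,
      Ds_const] at hds
    rw [Ht_add (smρ w) w.ρ_pos (sp.mul sp) (Sm.const T _) h0 h1,
      Ht_mul (smρ w) w.ρ_pos sp sp h0 h1, Ht_const]
    have hf := w.f_pos ξ t h0.le h1
    have e2 := Ht_p w h0 h1 (ξ := ξ)
    have e3 := yh w h0.le h1 (ξ := ξ)
    have e4 := ypos w h0.le h1 (ξ := ξ)
    have e5 := hA ξ t h0.le h1
    apply neg_of_sq_mul hf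
    generalize Ht ρ f g (Ds ρ f) ξ t = H at *
    generalize Ds ρ (Ds ρ f) ξ t = m at *
    generalize hk : f ξ t * Ds ρ g ξ t / g ξ t = k at *
    generalize Ds ρ f ξ t = p at *
    generalize (f ξ t) ^ 2 / (g ξ t) ^ 2 = y at *
    generalize hh f g ξ t = h at *
    generalize f ξ t = F at *
    have hp2 : p * p = 3 / 2 := by linarith
    have hy1 : y ≤ 1 := by nlinarith
    have hm : p * m = 0 := by linarith
    have hm0 : m = 0 := by
      rcases mul_eq_zero.1 hm with h | h
      · rw [h] at hp2; norm_num at hp2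
      · exact h
    rw [hm0] at e2 ⊢
    have : F ^ 2 * (H * p + p * H + 0 - 2 * 0 * 0)
        = 2 * p * (F ^ 2 * H) := by ring
    have e : F ^ 2 * (H * p + p * H - 2 * 0 * 0 + 0) = -4 * (p * k) ^ 2 - 12 * y ^ 2 * (p * p)
        + 16 * y ^ 2 * (p * k) := by
      calc _ = 2 * p * (F ^ 2 * H) := by ring
        _ = _ := by rw [e2]; ring
    rw [e, hp2]
    have : y ^ 2 * y ^ 2 ≤ y ^ 2 * 1 := by
      apply mul_le_mul_of_nonneg_left _ (by positivity); nlinarith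
    nlinarith [sq_nonneg (p * k - 2 * y ^ 2), pow_pos e4 2]

lemma step2 (w : WarpedBerger T f g ρ) (hA : ∀ ξ t : ℝ, 0 ≤ t → t < T → 0 ≤ hh f g ξ t)
    (hA' : ∀ ξ t : ℝ, 0 ≤ t → t < T → hh f g ξ t < 3)
    (hp : ∀ ξ t : ℝ, 0 ≤ t → t < T → (Ds ρ f ξ t) ^ 2 < 3 / 2) (C : ℝ)
    (hi : ∀ ξ, hh f g ξ 0 < C * f ξ 0) (hC : 0 < C) :
    ∀ ξ t : ℝ, 0 ≤ t → t < T → hh f g ξ t < C * f ξ t := by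
  intro ξ₀ t₀ a b
  have sh := smh w
  have sf := smf w
  have S1 : Sm T (fun _ _ => (-C : ℝ)) := Sm.const T _
  have key := max_principle (f := f) (g := g)
    (u := fun x τ => hh f g x τ + (-C) * f x τ)
    (smρ w) w.ρ_pos (sh.add (S1.mul sf))
    (fun ξ t _ _ => by rw [per_h w, w.f_per]) (fun ξ => by have := hi ξ; linarith) ?_ ξ₀ t₀ a b
  · linarith
  · intro ξ t h0 h1 hz hds
    rw [Ht_add (smρ w) w.ρ_pos sh (S1.mul sf) h0 h1,
      Ht_mul (smρ w) w.ρ_pos S1 sf h0 h1, Ht_const, Ds_const]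
    have hf := w.f_pos ξ t h0.le h1
    have e1 := Ht_f' w h0 h1 (ξ := ξ)
    have e2 := Ht_h w h0 h1 (ξ := ξ)
    have e3 := yh w h0.le h1 (ξ := ξ)
    have e4 := ypos w h0.le h1 (ξ := ξ)
    have e5 := hA ξ t h0.le h1
    have e6 := hA' ξ t h0.le h1
    have e7 := hp ξ t h0.le h1
    apply neg_of_sq_mul hf
    generalize Ht ρ f g f ξ t = H1 at *
    generalize Ht ρ f g (hh f g) ξ t = H2 at *
    generalize hk : f ξ t * Ds ρ g ξ t / g ξ t = k at *
    generalize Ds ρ f ξ t = p at *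
    generalize (f ξ t) ^ 2 / (g ξ t) ^ 2 = y at *
    generalize hh f g ξ t = h at *
    generalize f ξ t = F at *
    have hy1 : y ≤ 1 := by nlinarith
    have hy2 : 1 / 4 ≤ y := by nlinarith
    have hh0 : h = C * F := by linarith
    have hpos : 0 < h := by rw [hh0]; positivity
    have e : F ^ 2 * (H2 + (0 * F + -C * H1 - 2 * 0 * Ds ρ f ξ t)) =
      h * (p ^ 2 + 2 * y ^ 2 - 8 * y) - 4 * (1 + h) * (p - k) ^ 2 := by
      calc _ = F ^ 2 * H2 - C * (F ^ 2 * H1) := by ring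
        _ = -4 * (1 + h) * (p - k) ^ 2 - 8 * h * y + (C * F) * (p ^ 2 + 2 * y ^ 2) := by
          rw [e1, e2]; ring
        _ = _ := by rw [← hh0]; ring
    have e' : F ^ 2 * (H2 + (0 * F + -C * H1 - 2 * 0 * p)) =
      h * (p ^ 2 + 2 * y ^ 2 - 8 * y) - 4 * (1 + h) * (p - k) ^ 2 := by
      rw [← e]; ring
    rw [e']
    have n1 : p ^ 2 + 2 * y ^ 2 - 8 * y < 0 := by nlinarith
    have n2 : h * (p ^ 2 + 2 * y ^ 2 - 8 * y) < 0 := mul_neg_of_pos_of_neg hpos n1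
    have n3 : 0 ≤ 4 * (1 + h) * (p - k) ^ 2 := by positivity
    linarith

lemma alg3_t9 {F p y h C : ℝ} (hF : 0 < F) (hC : 0 < C) (h0 : 0 ≤ h) (h3 : h < 3)
    (hhC : h < C * F) (hp : p ^ 2 < 3 / 2) (hy2 : y ^ 2 ≤ 1) :
    |p * (8 * F * p ^ 2 - 16 * F * y ^ 2 - 16 * h * (1 + h))| ≤ (20 + 80 * C) * F := by
  have hpa : |p| ≤ 5 / 4 := by
    rw [abs_le]; constructor <;> nlinarith
  have b1 : h * (1 + h) ≤ (C * F) * 4 :=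
    mul_le_mul hhC.le (by linarith) (by linarith) (by positivity)
  have b2 : 0 ≤ h * (1 + h) := by positivity
  have b3 : F * p ^ 2 ≤ F * (3 / 2) := mul_le_mul_of_nonneg_left hp.le hF.le
  have b4 : F * y ^ 2 ≤ F * 1 := mul_le_mul_of_nonneg_left hy2 hF.le
  have b5 : 0 ≤ F * p ^ 2 := by positivity
  have b6 : 0 ≤ F * y ^ 2 := by positivity
  have b7 : 0 < C * F := by positivity
  have hb : |8 * F * p ^ 2 - 16 * F * y ^ 2 - 16 * h * (1 + h)| ≤ (16 + 64 * C) * F := by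
    rw [abs_le]; constructor <;> linarith
  rw [abs_mul]
  calc _ ≤ 5 / 4 * ((16 + 64 * C) * F) := mul_le_mul hpa hb (abs_nonneg _) (by norm_num)
    _ = _ := by ring

set_option maxHeartbeats 1000000 in
lemma alg3 {F p y h l m N C : ℝ} (hF : 0 < F) (hC : 0 < C) (h0 : 0 ≤ h) (h3 : h < 3)
    (hhC : h < C * F) (hp : p ^ 2 < 3 / 2) (y0 : 0 < y) (y1 : y ≤ 1)
    (hN : N = C ^ 2 + (20 + 80 * C) ^ 2 + 1)
    (hz : F * (p ^ 2 - 1) + h ^ 2 - N * F ^ 2 = 0)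
    (hs : F * p * (p ^ 2 - 1) + 2 * F * p * m - 4 * h * (1 + h) * l - 2 * N * F ^ 2 * p = 0) :
    -p ^ 2 * F * (p ^ 2 + 2 * y ^ 2) - 8 * p ^ 2 * F * m - 2 * F * m ^ 2
      - 4 * F * p ^ 2 * (p - l) ^ 2 + 4 * F * y ^ 2 * p ^ 2 - 16 * F * p * y ^ 2 * l
      + F * (p ^ 2 + 2 * y ^ 2) - 8 * h * (1 + h) * l ^ 2 - 16 * h ^ 2 * y
      - 8 * (1 + h) ^ 2 * l ^ 2 + N * F ^ 2 * (4 * p ^ 2 + 4 * y ^ 2) < 0 := by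
  set A := 20 + 80 * C with hA
  have hh2 : h ^ 2 ≤ C ^ 2 * F ^ 2 := by nlinarith
  have hpp : F * (p ^ 2 - 1) = N * F ^ 2 - h ^ 2 := by linarith
  have hNpos : 0 < N := by rw [hN]; positivity
  have hge : (N - C ^ 2) * F ^ 2 ≤ F * (p ^ 2 - 1) := by nlinarith
  have hNC : N - C ^ 2 = A ^ 2 + 1 := by rw [hN]; ring
  have hp1 : 1 ≤ p ^ 2 := by
    have : 0 ≤ F * (p ^ 2 - 1) := le_trans (by rw [hNC]; positivity) hge
    have := nonneg_of_mul_nonneg_right this hF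
    linarith
  have hy2 : y ^ 2 ≤ 1 := by nlinarith
  have id : -p ^ 2 * F * (p ^ 2 + 2 * y ^ 2) - 8 * p ^ 2 * F * m - 2 * F * m ^ 2
      - 4 * F * p ^ 2 * (p - l) ^ 2 + 4 * F * y ^ 2 * p ^ 2 - 16 * F * p * y ^ 2 * l
      + F * (p ^ 2 + 2 * y ^ 2) - 8 * h * (1 + h) * l ^ 2 - 16 * h ^ 2 * y
      - 8 * (1 + h) ^ 2 * l ^ 2 + N * F ^ 2 * (4 * p ^ 2 + 4 * y ^ 2)
      = - (F * (p ^ 2 - 1)) * (p ^ 2 + 2 * y ^ 2) - 4 * (F * p ^ 2 * (1 - y ^ 2))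
        - 4 * (N * F ^ 2 * (p ^ 2 - y ^ 2))
        + l * (p * (8 * F * p ^ 2 - 16 * F * y ^ 2 - 16 * h * (1 + h)))
        - 4 * (F * p ^ 2 * l ^ 2) - 2 * (F * m ^ 2) - 8 * (h * (1 + h) * l ^ 2)
        - 16 * (h ^ 2 * y) - 8 * ((1 + h) ^ 2 * l ^ 2) := by
    linear_combination (-4 * p) * hs
  rw [id]
  have t1 : (A ^ 2 + 1) * F ^ 2 ≤ (F * (p ^ 2 - 1)) * (p ^ 2 + 2 * y ^ 2) := by
    rw [hNC] at hge
    have k1 : 0 ≤ F * (p ^ 2 - 1) := le_trans (by positivity) hge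
    nlinarith [mul_nonneg k1 (by nlinarith : 0 ≤ p ^ 2 + 2 * y ^ 2 - 1)]
  have t2 : 0 ≤ F * p ^ 2 * (1 - y ^ 2) := mul_nonneg (by positivity) (by linarith)
  have t3 : 0 ≤ N * F ^ 2 * (p ^ 2 - y ^ 2) := mul_nonneg (by positivity) (by linarith)
  have t4 : 0 ≤ F * p ^ 2 * l ^ 2 := by positivity
  have t5 : 0 ≤ F * m ^ 2 := by positivity
  have t6 : 0 ≤ h * (1 + h) * l ^ 2 := by positivity
  have t7 : 0 ≤ h ^ 2 * y := by positivity
  have t8 : l ^ 2 ≤ (1 + h) ^ 2 * l ^ 2 := by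
    have : 1 ≤ (1 + h) ^ 2 := by nlinarith
    nlinarith [sq_nonneg l]
  have t9 : |p * (8 * F * p ^ 2 - 16 * F * y ^ 2 - 16 * h * (1 + h))| ≤ A * F :=
    alg3_t9 hF hC h0 h3 hhC hp hy2
  generalize hB : p * (8 * F * p ^ 2 - 16 * F * y ^ 2 - 16 * h * (1 + h)) = B at *
  have t10 : B ^ 2 ≤ A ^ 2 * F ^ 2 := by
    rw [← mul_pow]; exact sq_le_sq' (by linarith [(abs_le.1 t9).1]) (abs_le.1 t9).2
  have t11 : l * B ≤ 8 * l ^ 2 + B ^ 2 / 32 := by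
    have := sq_nonneg (16 * l - B)
    rw [show (16 * l - B) ^ 2 = 32 * (8 * l ^ 2 + B ^ 2 / 32 - l * B) by ring] at this
    clear * - this
    linarith
  have t12 : 0 < F ^ 2 := by positivity
  have t13 : 0 ≤ A ^ 2 * F ^ 2 := by positivity
  have t14 : (A ^ 2 + 1) * F ^ 2 = A ^ 2 * F ^ 2 + F ^ 2 := by ring
  rw [t14] at t1
  clear hs hz hN hA hpp hNC hge hh2 id
  linarith

lemma step3 (w : WarpedBerger T f g ρ) (hA : ∀ ξ t : ℝ, 0 ≤ t → t < T → 0 ≤ hh f g ξ t)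
    (hA' : ∀ ξ t : ℝ, 0 ≤ t → t < T → hh f g ξ t < 3)
    (hp : ∀ ξ t : ℝ, 0 ≤ t → t < T → (Ds ρ f ξ t) ^ 2 < 3 / 2) (C : ℝ) (hC : 0 < C)
    (hi : ∀ ξ, (Ds ρ f ξ 0) ^ 2 ≤ 1)
    (h2 : ∀ ξ t : ℝ, 0 ≤ t → t < T → hh f g ξ t < C * f ξ t) :
    ∃ N : ℝ, 0 < N ∧ ∀ ξ t : ℝ, 0 ≤ t → t < T → (Ds ρ f ξ t) ^ 2 < 1 + N * f ξ t := by
  obtain ⟨N, hN⟩ : ∃ N : ℝ, N = C ^ 2 + (20 + 80 * C) ^ 2 + 1 := ⟨_, rfl⟩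
  have hNpos : 0 < N := by rw [hN]; positivity
  refine ⟨N, hNpos, ?_⟩
  intro ξ₀ t₀ a b
  have sh := smh w
  have sf := smf w
  have sp := smp w
  have sN : Sm T (fun _ _ => (-N : ℝ)) := Sm.const T _
  have s1 : Sm T (fun _ _ => (-1 : ℝ)) := Sm.const T _
  have sA := (sp.mul sp).add s1
  have sB := sN.mul (sf.mul sf)
  have key := max_principle (f := f) (g := g)
    (u := fun x τ => f x τ * (Ds ρ f x τ * Ds ρ f x τ + (-1)) +
      (hh f g x τ * hh f g x τ + (-N) * (f x τ * f x τ)))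
    (smρ w) w.ρ_pos ((sf.mul sA).add ((sh.mul sh).add sB))
    (fun ξ t _ _ => by rw [per_h w, w.f_per, per_p w]) ?_ ?_ ξ₀ t₀ a b
  · have hf := w.f_pos ξ₀ t₀ a b
    have : f ξ₀ t₀ * ((Ds ρ f ξ₀ t₀) ^ 2 - 1 - N * f ξ₀ t₀) < 0 := by
      nlinarith [sq_nonneg (hh f g ξ₀ t₀)]
    have := (pos_iff_neg_of_mul_neg this).1 hf
    linarith
  · intro ξ
    have hf := w.f_pos ξ 0 le_rfl w.T_pos
    have q1 := hA ξ 0 le_rfl w.T_pos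
    have q2 := h2 ξ 0 le_rfl w.T_pos
    have q3 := hi ξ
    have q4 : hh f g ξ 0 * hh f g ξ 0 ≤ C ^ 2 * (f ξ 0) ^ 2 := by nlinarith
    have q5 : f ξ 0 * (Ds ρ f ξ 0 * Ds ρ f ξ 0 + (-1)) ≤ 0 := by nlinarith
    have q6 : C ^ 2 * (f ξ 0) ^ 2 < N * (f ξ 0) ^ 2 := by
      apply mul_lt_mul_of_pos_right _ (by positivity)
      rw [hN]; nlinarith [sq_nonneg (20 + 80 * C)]
    nlinarith
  · intro ξ t h0 h1 hz hds
    rw [Ds_add (sf.mul sA) ((sh.mul sh).add sB) h0.le h1, Ds_mul sf sA h0.le h1,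
      Ds_add (sp.mul sp) s1 h0.le h1, Ds_mul sp sp h0.le h1, Ds_add (sh.mul sh) sB h0.le h1,
      Ds_mul sh sh h0.le h1, Ds_mul sN (sf.mul sf) h0.le h1, Ds_mul sf sf h0.le h1,
      Ds_const, Ds_const] at hds
    rw [Ht_add (smρ w) w.ρ_pos (sf.mul sA) ((sh.mul sh).add sB) h0 h1,
      Ht_mul (smρ w) w.ρ_pos sf sA h0 h1,
      Ht_add (smρ w) w.ρ_pos (sp.mul sp) s1 h0 h1,
      Ht_mul (smρ w) w.ρ_pos sp sp h0 h1,
      Ht_add (smρ w) w.ρ_pos (sh.mul sh) sB h0 h1,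
      Ht_mul (smρ w) w.ρ_pos sh sh h0 h1,
      Ht_mul (smρ w) w.ρ_pos sN (sf.mul sf) h0 h1,
      Ht_mul (smρ w) w.ρ_pos sf sf h0 h1,
      Ds_add (sp.mul sp) s1 h0.le h1, Ds_mul sp sp h0.le h1,
      Ht_const, Ht_const, Ds_const, Ds_const]
    have hf := w.f_pos ξ t h0.le h1
    have e0 := Ht_p w h0 h1 (ξ := ξ)
    have e1 := Ht_f' w h0 h1 (ξ := ξ)
    have e2 := Ht_h w h0 h1 (ξ := ξ)
    have eD := Ds_h w h0.le h1 (ξ := ξ)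
    have e3 := yh w h0.le h1 (ξ := ξ)
    have e4 := ypos w h0.le h1 (ξ := ξ)
    have e5 := hA ξ t h0.le h1
    have e6 := hA' ξ t h0.le h1
    have e7 := hp ξ t h0.le h1
    have e8 := h2 ξ t h0.le h1
    apply neg_of_sq_mul hf
    clear hi hA hA' hp h2
    generalize Ds ρ (fun x τ => f x τ * f x τ) ξ t = junk at *
    generalize Ht ρ f g f ξ t = H1 at *
    generalize Ht ρ f g (hh f g) ξ t = H2 at *
    generalize Ht ρ f g (Ds ρ f) ξ t = H3 at *
    generalize Ds ρ (Ds ρ f) ξ t = m at *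
    generalize Ds ρ (hh f g) ξ t = h' at *
    generalize hk : f ξ t * Ds ρ g ξ t / g ξ t = k at *
    generalize Ds ρ f ξ t = p at *
    generalize (f ξ t) ^ 2 / (g ξ t) ^ 2 = y at *
    generalize hh f g ξ t = h at *
    generalize f ξ t = F at *
    have hy1 : y ≤ 1 := by nlinarith
    have fin := alg3 (F := F) (p := p) (y := y) (h := h) (l := p - k) (m := F * m) (N := N)
      (C := C) hf hC e5 e6 e8 e7 e4 hy1 hN (by linarith) (by
        linear_combination F * hds - 2 * h * eD)
    refine lt_of_eq_of_lt ?_ fin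
    linear_combination (p * p - 1 - 2 * N * F) * e1 + 2 * h * e2 + 2 * F * p * e0
      - 2 * (F * h' - 2 * (1 + h) * (p - k)) * eD

lemma alg4_a {F h C c D : ℝ} (hF : 0 < F) (hC : 0 < C) (hc : 0 < c)
    (hhC : h < C * F) (hD : 2 * C * c + 1 ≤ D)
    (hz : h * (1 + c * F) - D * F ^ 2 = 0) : c * F ≤ 1 := by
  have q : 0 < 1 + c * F := by positivity
  have a0 := mul_lt_mul_of_pos_right hhC q
  have a1 : F * (D * F) < F * (C * (1 + c * F)) := by linarith
  have a2 : D * F < C * (1 + c * F) := lt_of_mul_lt_mul_left a1 hF.le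
  have a4 := mul_le_mul_of_nonneg_right hD hF.le
  have a3 : C * (c * F) < C * 1 := by linarith
  exact (lt_of_mul_lt_mul_left a3 hC.le).le

lemma alg4_c {a b v : ℝ} (ha : 0 < a) (hb : 0 < b) (hv : v = 4 * a + 4 * b) (h1 : v ≤ 1) :
    (1 + a) * (4 + 3 * v + v ^ 2) + (1 + v) ^ 2 * (-4 + 4 * b) < 0 := by
  have v0 : 0 < v := by linarith
  have e : (1 + a) * (4 + 3 * v + v ^ 2) + (1 + v) ^ 2 * (-4 + 4 * b)
      = v * (-4 - 3 * v + (3 * a + 8 * b) + v * (a + 4 * b)) := by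
    linear_combination (-1) * hv
  rw [e]
  apply mul_neg_of_pos_of_neg v0
  have : v * (a + 4 * b) ≤ v * 1 := mul_le_mul_of_nonneg_left (by linarith) v0.le
  linarith

lemma alg4_b {a b v y p s : ℝ} (ha : 0 < a) (hb : 0 < b) (hv : v = 4 * a + 4 * b) (h1 : v ≤ 1)
    (hp : p ^ 2 < 1 + a) (y0 : 0 < y) (y1 : y ≤ 1) (hy : 1 - y ≤ b) (hs : s = 1 + v) :
    p ^ 2 * (4 * s ^ 2 - 5 * s * v + 2 * v ^ 2)
      + 2 * y ^ 2 * s * (2 * s - v) - 8 * y * s ^ 2 < 0 := by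
  have v0 : 0 < v := by linarith
  have s0 : 0 < s := by linarith
  have k1 : 4 * s ^ 2 - 5 * s * v + 2 * v ^ 2 = 4 + 3 * v + v ^ 2 := by rw [hs]; ring
  have k2 : p ^ 2 * (4 + 3 * v + v ^ 2) ≤ (1 + a) * (4 + 3 * v + v ^ 2) :=
    mul_le_mul_of_nonneg_right hp.le (by positivity)
  have k3 : 2 * y ^ 2 * s * (2 * s - v) - 8 * y * s ^ 2 ≤ s ^ 2 * (4 * y ^ 2 - 8 * y) := by
    have : 0 ≤ y ^ 2 * s * v := by positivity
    linarith
  have k4 : 4 * y ^ 2 - 8 * y ≤ -4 + 4 * b := by nlinarith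
  have k5 : s ^ 2 * (4 * y ^ 2 - 8 * y) ≤ s ^ 2 * (-4 + 4 * b) :=
    mul_le_mul_of_nonneg_left k4 (by positivity)
  have k6 := alg4_c ha hb hv h1
  rw [k1]
  rw [← hs] at k6
  linarith

lemma alg4 {F p y h l N C c D : ℝ} (hF : 0 < F) (hC : 0 < C) (hN : 0 < N) (h0 : 0 ≤ h)
    (hhC : h < C * F) (hp : p ^ 2 < 1 + N * F) (y0 : 0 < y) (y1 : y ≤ 1)
    (hy : y * (1 + h) = 1)
    (hc : c = 4 * (N + C)) (hD : 2 * C * c + 1 ≤ D)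
    (hz : h * (1 + c * F) - D * F ^ 2 = 0)
    (hs : (1 + c * F) * (-2 * (1 + h) * l) + h * c * F * p - 2 * D * F ^ 2 * p = 0) :
    (1 + c * F) * (-4 * (1 + h) * l ^ 2 - 8 * h * y) + c * h * F * (-p ^ 2 - 2 * y ^ 2)
      + 4 * c * F * (1 + h) * l * p + D * F ^ 2 * (4 * p ^ 2 + 4 * y ^ 2) < 0 := by
  have hc0 : 0 < c := by rw [hc]; positivity
  have hcF : 0 < c * F := by positivity
  have hD0 : 0 < D := lt_of_lt_of_le (by positivity) hD
  have hcF1 : c * F ≤ 1 := alg4_a hF hC hc0 hhC hD hz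
  have hpos : 0 < h := by
    have : 0 < h * (1 + c * F) := by have : 0 < D * F ^ 2 := by positivity
                                     linarith
    exact pos_of_mul_pos_left this (by positivity)
  set s := 1 + c * F with hsdef
  have hs0 : 0 < s := by positivity
  have hDF : D * F ^ 2 = h * s := by linarith
  have hl : 2 * s * ((1 + h) * l) = h * p * (c * F - 2 * s) := by
    rw [show (2 : ℝ) * D * F ^ 2 * p = 2 * (D * F ^ 2) * p by ring, hDF] at hs
    linarith
  have hy3 : 1 - y ≤ C * F := by
    have e : 1 - y = h * y := by linarith
    have : h * y ≤ h * 1 := mul_le_mul_of_nonneg_left y1 h0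
    linarith
  -- multiply by `s`
  have main : s * ((1 + c * F) * (-4 * (1 + h) * l ^ 2 - 8 * h * y)
      + c * h * F * (-p ^ 2 - 2 * y ^ 2)
      + 4 * c * F * (1 + h) * l * p + D * F ^ 2 * (4 * p ^ 2 + 4 * y ^ 2))
      = - 4 * (s ^ 2 * (1 + h) * l ^ 2) + h * (p ^ 2 * (4 * s ^ 2 - 5 * s * (c * F)
        + 2 * (c * F) ^ 2) + 2 * y ^ 2 * s * (2 * s - c * F) - 8 * y * s ^ 2) := by
    rw [hDF, ← hsdef]
    linear_combination (2 * c * F * p) * hl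
  have n0 : 0 ≤ s ^ 2 * (1 + h) * l ^ 2 := by positivity
  have n1 : p ^ 2 * (4 * s ^ 2 - 5 * s * (c * F) + 2 * (c * F) ^ 2)
      + 2 * y ^ 2 * s * (2 * s - c * F) - 8 * y * s ^ 2 < 0 := by
    have k6 : c * F = 4 * (N * F) + 4 * (C * F) := by rw [hc]; ring
    exact alg4_b (a := N * F) (b := C * F) (by positivity) (by positivity) k6 hcF1 hp y0 y1 hy3 hsdef
  have n2 := mul_neg_of_pos_of_neg hpos n1
  have n3 : s * ((1 + c * F) * (-4 * (1 + h) * l ^ 2 - 8 * h * y)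
      + c * h * F * (-p ^ 2 - 2 * y ^ 2)
      + 4 * c * F * (1 + h) * l * p + D * F ^ 2 * (4 * p ^ 2 + 4 * y ^ 2)) < 0 := by
    rw [main]; linarith
  exact (pos_iff_neg_of_mul_neg n3).1 hs0

lemma step4 (w : WarpedBerger T f g ρ) (hA : ∀ ξ t : ℝ, 0 ≤ t → t < T → 0 ≤ hh f g ξ t)
    (C N c D : ℝ) (hC : 0 < C) (hN : 0 < N)
    (h2 : ∀ ξ t : ℝ, 0 ≤ t → t < T → hh f g ξ t < C * f ξ t)
    (h3 : ∀ ξ t : ℝ, 0 ≤ t → t < T → (Ds ρ f ξ t) ^ 2 < 1 + N * f ξ t)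
    (hc : c = 4 * (N + C)) (hD : 2 * C * c + 1 ≤ D)
    (hi : ∀ ξ, hh f g ξ 0 * (1 + c * f ξ 0) < D * (f ξ 0) ^ 2) :
    ∀ ξ t : ℝ, 0 ≤ t → t < T → hh f g ξ t * (1 + c * f ξ t) < D * (f ξ t) ^ 2 := by
  intro ξ₀ t₀ a b
  have sh := smh w
  have sf := smf w
  have sc : Sm T (fun _ _ => (c : ℝ)) := Sm.const T _
  have sD : Sm T (fun _ _ => (-D : ℝ)) := Sm.const T _
  have s1 : Sm T (fun _ _ => (1 : ℝ)) := Sm.const T _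
  have sA := s1.add (sc.mul sf)
  have sB := sD.mul (sf.mul sf)
  have key := max_principle (f := f) (g := g)
    (u := fun x τ => hh f g x τ * (1 + c * f x τ) + (-D) * (f x τ * f x τ))
    (smρ w) w.ρ_pos ((sh.mul sA).add sB)
    (fun ξ t _ _ => by rw [per_h w, w.f_per]) ?_ ?_ ξ₀ t₀ a b
  · linarith
  · intro ξ
    have := hi ξ
    linarith
  · intro ξ t h0 h1 hz hds
    rw [Ds_add (sh.mul sA) sB h0.le h1, Ds_mul sh sA h0.le h1,
      Ds_add s1 (sc.mul sf) h0.le h1, Ds_mul sc sf h0.le h1,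
      Ds_mul sD (sf.mul sf) h0.le h1, Ds_mul sf sf h0.le h1,
      Ds_const, Ds_const, Ds_const] at hds
    rw [Ht_add (smρ w) w.ρ_pos (sh.mul sA) sB h0 h1,
      Ht_mul (smρ w) w.ρ_pos sh sA h0 h1,
      Ht_add (smρ w) w.ρ_pos s1 (sc.mul sf) h0 h1,
      Ht_mul (smρ w) w.ρ_pos sc sf h0 h1,
      Ht_mul (smρ w) w.ρ_pos sD (sf.mul sf) h0 h1,
      Ht_mul (smρ w) w.ρ_pos sf sf h0 h1,
      Ds_add s1 (sc.mul sf) h0.le h1, Ds_mul sc sf h0.le h1,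
      Ht_const, Ht_const, Ht_const, Ds_const, Ds_const, Ds_const]
    have hf := w.f_pos ξ t h0.le h1
    have e1 := Ht_f' w h0 h1 (ξ := ξ)
    have e2 := Ht_h w h0 h1 (ξ := ξ)
    have eD := Ds_h w h0.le h1 (ξ := ξ)
    have e3 := yh w h0.le h1 (ξ := ξ)
    have e4 := ypos w h0.le h1 (ξ := ξ)
    have e5 := hA ξ t h0.le h1
    have e7 := h3 ξ t h0.le h1
    have e8 := h2 ξ t h0.le h1
    apply neg_of_sq_mul hf
    clear hi hA h2 h3
    generalize Ds ρ (fun x τ => f x τ * f x τ) ξ t = junk at *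
    generalize Ht ρ f g f ξ t = H1 at *
    generalize Ht ρ f g (hh f g) ξ t = H2 at *
    generalize Ds ρ (hh f g) ξ t = h' at *
    generalize hk : f ξ t * Ds ρ g ξ t / g ξ t = k at *
    generalize Ds ρ f ξ t = p at *
    generalize (f ξ t) ^ 2 / (g ξ t) ^ 2 = y at *
    generalize hh f g ξ t = h at *
    generalize f ξ t = F at *
    have hy1 : y ≤ 1 := by nlinarith
    have fin := alg4 (F := F) (p := p) (y := y) (h := h) (l := p - k) (N := N)
      (C := C) (c := c) (D := D) hf hC hN e5 e8 e7 e4 hy1 e3 hc hD (by linarith) (by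
        linear_combination F * hds - (1 + c * F) * eD)
    refine lt_of_eq_of_lt ?_ fin
    linear_combination (c * h - 2 * D * F) * e1 + (1 + c * F) * e2
      - 2 * c * F * p * eD

lemma final (w : WarpedBerger T f g ρ) (i0 : ∀ ξ, 0 ≤ hh f g ξ 0) (i3 : ∀ ξ, hh f g ξ 0 < 3)
    (ip : ∀ ξ, (Ds ρ f ξ 0) ^ 2 ≤ 1) :
    ∃ D : ℝ, 0 < D ∧ ∀ ξ t : ℝ, 0 ≤ t → t < T → hh f g ξ t < D * (f ξ t) ^ 2 := by
  obtain ⟨m, hm, hfm⟩ : ∃ m : ℝ, 0 < m ∧ ∀ ξ, m ≤ f ξ 0 := by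
    have hcont : Continuous (fun x => f x 0) := ((smf w).cd1 le_rfl w.T_pos).continuous
    obtain ⟨x0, -, hx0⟩ := isCompact_Icc.exists_isMinOn
      (⟨0, by constructor <;> positivity⟩ : (Set.Icc (0 : ℝ) (2 * π)).Nonempty) hcont.continuousOn
    refine ⟨f x0 0, w.f_pos x0 0 le_rfl w.T_pos, fun ξ => ?_⟩
    have hper : Function.Periodic (fun x => f x 0) (2 * π) := fun x => w.f_per x 0
    obtain ⟨y, hy, hye⟩ := hper.exists_mem_Ico₀ (by positivity) ξ
    have := hx0 (Set.Ico_subset_Icc_self hy)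
    have h' : f x0 0 ≤ f y 0 := this
    have h'' : f ξ 0 = f y 0 := hye
    rw [h'']; exact h'
  have hA := stepA w i0
  have hA' := stepA' w i3
  have hp := step1 w hA ip
  have hC : 0 < 3 / m := by positivity
  obtain ⟨C, hCe⟩ : ∃ C, C = 3 / m := ⟨_, rfl⟩
  rw [← hCe] at hC
  have hCm : C * m = 3 := by rw [hCe]; field_simp
  have iC : ∀ ξ, hh f g ξ 0 < C * f ξ 0 := fun ξ => by
    have a1 := i3 ξ
    have a2 := mul_le_mul_of_nonneg_left (hfm ξ) hC.le
    linarith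
  have h2 := step2 w hA hA' hp C iC hC
  obtain ⟨N, hN, h3⟩ := step3 w hA hA' hp C hC ip h2
  obtain ⟨c, hc⟩ : ∃ c, c = 4 * (N + C) := ⟨_, rfl⟩
  have hc0 : 0 < c := by rw [hc]; positivity
  have hCm0 : 0 < C / m := by positivity
  have hD0 : 0 < 2 * C * c + 1 + C / m := by positivity
  refine ⟨2 * C * c + 1 + C / m, hD0, ?_⟩
  have h4 := step4 w hA C N c (2 * C * c + 1 + C / m) hC hN h2 h3 hc (by linarith) (fun ξ => by
    have hf := w.f_pos ξ 0 le_rfl w.T_pos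
    have hq : 0 < 1 + c * f ξ 0 := by positivity
    have a1 := mul_lt_mul_of_pos_right (iC ξ) hq
    have a2 : C ≤ C / m * f ξ 0 := by
      rw [div_mul_eq_mul_div, le_div_iff₀ hm]
      exact mul_le_mul_of_nonneg_left (hfm ξ) hC.le
    have a3 := mul_le_mul_of_nonneg_right a2 hf.le
    have a4 : 0 < C * c * (f ξ 0) ^ 2 := by positivity
    have a5 : 0 < (f ξ 0) ^ 2 := by positivity
    linarith)
  intro ξ t h0 h1
  have hf := w.f_pos ξ t h0 h1
  have b1 := h4 ξ t h0 h1
  have b2 := mul_nonneg (hA ξ t h0 h1) (mul_pos hc0 hf).le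
  linarith

end main

/-- Under Assumption B there is a uniform constant `C` such that for
all `t` sufficiently close to `T` and all `ξ`, one has `g − f ≤ C·f³·|log(T−t)|`. -/
theorem log_improved_pinching (T : ℝ) (f g ρ : ℝ → ℝ → ℝ)
    (sol : AssumptionB T f g ρ) :
    ∃ C t₁ : ℝ, 0 ≤ t₁ ∧ t₁ < T ∧
      ∀ ξ t : ℝ, t₁ < t → t < T →
        g ξ t - f ξ t ≤ C * (f ξ t) ^ 3 * |Real.log (T - t)| := by
  have w : WarpedBerger T f g ρ := sol.toWarpedBerger
  have hT := w.T_pos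
  have i0 : ∀ ξ, 0 ≤ hh f g ξ 0 := by
    intro ξ
    have hf := w.f_pos ξ 0 le_rfl hT
    have ho := sol.init_order ξ
    have e : hh f g ξ 0 = (g ξ 0 - f ξ 0) * (g ξ 0 + f ξ 0) / (f ξ 0) ^ 2 := by
      unfold hh; field_simp; ring
    rw [e]
    apply div_nonneg (mul_nonneg (by linarith) (by linarith)) (by positivity)
  have i3 : ∀ ξ, hh f g ξ 0 < 3 := by
    intro ξ
    obtain ⟨ε, e0, e1, e2, e3⟩ := sol.init_pinched
    have hf := w.f_pos ξ 0 le_rfl hT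
    have hg := w.g_pos ξ 0 le_rfl hT
    have hε : 1 / 2 < 1 - ε := by
      by_contra hc
      push Not at hc
      have q0 : 0 ≤ 1 - ε := by linarith
      have q4 := pow_le_pow_left₀ q0 hc 4
      have q5 := pow_le_pow_left₀ q0 hc 5
      norm_num at q4 q5 e2
      linarith
    have hlt : g ξ 0 < 2 * f ξ 0 := by
      have := mul_lt_mul_of_pos_right hε hg
      have := e3 ξ
      linarith
    have e : hh f g ξ 0 = (g ξ 0) ^ 2 / (f ξ 0) ^ 2 - 1 := by
      unfold hh; field_simp; ring
    rw [e]
    have : (g ξ 0) ^ 2 / (f ξ 0) ^ 2 < 4 := by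
      rw [div_lt_iff₀ (by positivity)]
      nlinarith
    linarith
  have ip : ∀ ξ, (Ds ρ f ξ 0) ^ 2 ≤ 1 := fun ξ => (sq_le_one_iff_abs_le_one _).2 (sol.init_fs ξ)
  obtain ⟨D, hD, hfin⟩ := final w i0 i3 ip
  refine ⟨D, max 0 (T - Real.exp (-1)), le_max_left _ _,
    max_lt hT (by linarith [Real.exp_pos (-1)]), ?_⟩
  intro ξ t h1 h2
  have ht0 : 0 ≤ t := (lt_of_le_of_lt (le_max_left _ _) h1).le
  have ht1 : T - Real.exp (-1) < t := lt_of_le_of_lt (le_max_right _ _) h1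
  have hf := w.f_pos ξ t ht0 h2
  have hg := w.g_pos ξ t ht0 h2
  have hlog : 1 ≤ |Real.log (T - t)| := by
    have : Real.log (T - t) ≤ -1 := by
      rw [Real.log_le_iff_le_exp (by linarith)]; linarith
    rw [abs_of_neg (by linarith)]; linarith
  have hb := hfin ξ t ht0 h2
  have key : g ξ t - f ξ t ≤ D * (f ξ t) ^ 3 := by
    have e : hh f g ξ t * (f ξ t) ^ 2 = (g ξ t - f ξ t) * (g ξ t + f ξ t) := by
      unfold hh; field_simp; ring
    have hb' := mul_lt_mul_of_pos_right hb (by positivity : 0 < (f ξ t) ^ 2)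
    rw [e] at hb'
    by_contra hc
    push Not at hc
    have hpos : 0 < D * (f ξ t) ^ 3 := by positivity
    have : D * (f ξ t) ^ 3 * f ξ t ≤ (g ξ t - f ξ t) * (g ξ t + f ξ t) :=
      mul_le_mul hc.le (by linarith) hf.le (by linarith)
    linarith
  have h3 : D * (f ξ t) ^ 3 * 1 ≤ D * (f ξ t) ^ 3 * |Real.log (T - t)| :=
    mul_le_mul_of_nonneg_left hlog (by positivity)
  linarith
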